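/- Let H be an infinite-dimensional real Hilbert space and ℓ a continuous linear functional on B(H) with ℓ(𝟙) = 1 and ℓ(K) = 0 for every compact operator K; for smooth f : H → ℝ and v ∈ H set δ_ℓ(f)(v) := ℓ(A_{f''_v}), where A_{f''_v} represents the second Fréchet derivative of f at v. Then there exist no ε > 0 and differentiable curve v : (−ε,ε) → H such that for every smooth f : H → ℝ and every t ∈ (−ε,ε), (d/dt) f(v(t)) = δ_ℓ(f)(v(t)). (Indeed, testing on continuous linear functionals f forces v to be constant, while testing on ρ(u) = ⟨u,u⟩ forces (d/dt)ρ(v(t)) = 2; hence the Hamilton equation associated to this queer vector field is not solvable.) -/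

import Mathlib

/-- The bounded operator `A` representing a bounded bilinear form `B` on a real
Hilbert space via `B(v,w) = ⟨A v, w⟩` (using the Riesz representation). -/
noncomputable def bilinToOp {H : Type*} [NormedAddCommGroup H] [InnerProductSpace ℝ H]
    [CompleteSpace H] (B : H →L[ℝ] H →L[ℝ] ℝ) : H →L[ℝ] H :=
  (InnerProductSpace.toDual ℝ H).symm.toContinuousLinearEquiv.toContinuousLinearMap.comp B

/-- The queer operational vector field `δ_ℓ(f)(v) := ℓ(A_{f''_v})`. -/
noncomputable def deltaEll {H : Type*} [NormedAddCommGroup H] [InnerProductSpace ℝ H]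
    [CompleteSpace H] (ℓ : (H →L[ℝ] H) →L[ℝ] ℝ) (f : H → ℝ) (v : H) : ℝ :=
  ℓ (bilinToOp (fderiv ℝ (fderiv ℝ f) v))

/-- The Hamilton equation associated to the queer vector field `δ_ℓ` is not
solvable: there is no `ε > 0` and differentiable curve `v : (−ε,ε) → H` with
`(d/dt) f(v(t)) = δ_ℓ(f)(v(t))` for all smooth `f : H → ℝ` and all
`t ∈ (−ε,ε)`. -/
theorem hamilton_equation_of_queer_field_not_solvable
    {H : Type*} [NormedAddCommGroup H] [InnerProductSpace ℝ H] [CompleteSpace H]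
    (hinf : ¬ FiniteDimensional ℝ H)
    (ℓ : (H →L[ℝ] H) →L[ℝ] ℝ)
    (hid : ℓ (ContinuousLinearMap.id ℝ H) = 1)
    (hcpt : ∀ K : H →L[ℝ] H, IsCompactOperator K → ℓ K = 0) :
    ¬ ∃ (ε : ℝ), 0 < ε ∧ ∃ v : ℝ → H,
      (∀ t ∈ Set.Ioo (-ε) ε, DifferentiableAt ℝ v t) ∧
      (∀ f : H → ℝ, ContDiff ℝ (⊤ : ℕ∞) f → ∀ t ∈ Set.Ioo (-ε) ε,
        deriv (fun s => f (v s)) t = deltaEll ℓ f (v t)) := by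
  rintro ⟨ε, hε, v, hv, h⟩
  have h0 : (0 : ℝ) ∈ Set.Ioo (-ε) ε := ⟨by linarith, hε⟩
  have hd := (hv 0 h0).hasDerivAt
  set w := deriv v 0 with hw
  have hw0 : w = 0 := by
    have h1 := h (fun x => innerSL ℝ w x) (innerSL ℝ w).contDiff 0 h0
    have h2 : HasDerivAt (fun s => innerSL ℝ w (v s)) (innerSL ℝ w w) 0 :=
      (innerSL ℝ w).hasFDerivAt.comp_hasDerivAt 0 hd
    have h3 : fderiv ℝ (fun x => innerSL ℝ w x) = fun _ => innerSL ℝ w := by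
      funext x
      exact (innerSL ℝ w).hasFDerivAt.fderiv
    have h4 : bilinToOp (0 : H →L[ℝ] H →L[ℝ] ℝ) = 0 := by
      ext x; simp [bilinToOp]
    rw [h2.deriv, deltaEll, h3, fderiv_fun_const, Pi.zero_apply, h4, map_zero] at h1
    rw [innerSL_apply_apply] at h1
    exact inner_self_eq_zero.mp h1
  have h1 := h (fun x => inner ℝ x x) (contDiff_id.inner ℝ contDiff_id) 0 h0
  have h2 := hd.inner ℝ hd
  have h3 : fderiv ℝ (fun x : H => inner ℝ x x)
      = fun x => ((2 : ℝ) • (innerSL ℝ : H →L[ℝ] H →L[ℝ] ℝ)) x := by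
    funext x
    have := (hasFDerivAt_id (𝕜 := ℝ) x).inner ℝ (hasFDerivAt_id x)
    refine HasFDerivAt.fderiv (this.congr_fderiv ?_)
    ext y
    simp [real_inner_comm, two_mul]
  have h4 : bilinToOp ((2 : ℝ) • (innerSL ℝ : H →L[ℝ] H →L[ℝ] ℝ))
      = (2 : ℝ) • ContinuousLinearMap.id ℝ H := by
    ext x
    refine (InnerProductSpace.toDual ℝ H).injective ?_
    ext y
    simp [bilinToOp]
    exact innerSL_apply_apply ℝ x y
  rw [h2.deriv, deltaEll, h3, ContinuousLinearMap.fderiv, h4, map_smul, hid, hw0] at h1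
  norm_num at h1
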